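/- For every ξ > 0 and every nonzero x in R^3, the Beenakker splitting function Φ_B(r, ξ) = r erf(ξ r), evaluated at r = |x|, satisfies the biharmonic relation Δ^2 [ |x| erf(ξ |x|) ] = −8π · ξ^3 π^{-3/2} e^{-ξ^2 |x|^2} (10 − 11 ξ^2 |x|^2 + 2 ξ^4 |x|^4), where Δ^2 is the bi-Laplacian (Laplacian applied twice) on R^3. -/

import Mathlib

open MeasureTheory Real Filter

noncomputable section

/-- Euclidean 3-space. -/
abbrev E3 := EuclideanSpace ℝ (Fin 3)

/-- Partial derivative in the `j`-th coordinate direction. -/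
def pd (j : Fin 3) (f : E3 → ℝ) (x : E3) : ℝ :=
  fderiv ℝ f x (EuclideanSpace.single j 1)

/-- Laplacian on `E3`. -/
def lap (f : E3 → ℝ) (x : E3) : ℝ :=
  ∑ i : Fin 3, pd i (pd i f) x

/-- Gauss error function. -/
def erf (t : ℝ) : ℝ := (2 / Real.sqrt π) * ∫ s in (0:ℝ)..t, Real.exp (-s ^ 2)

/-- Complementary error function. -/
def erfc (t : ℝ) : ℝ := 1 - erf t

/-- Kronecker delta on `Fin 3`. -/
def kron (j l : Fin 3) : ℝ := if j = l then 1 else 0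

/-- Levi-Civita symbol on `Fin 3`. -/
def lev (j l m : Fin 3) : ℝ :=
  ((l.val : ℝ) - (j.val : ℝ)) * ((m.val : ℝ) - (l.val : ℝ)) * ((m.val : ℝ) - (j.val : ℝ)) / 2

theorem hasFDerivAt_norm_of_ne_zero {x : E3} (hx : x ≠ 0) :
    HasFDerivAt (fun y : E3 => ‖y‖) (‖x‖⁻¹ • innerSL ℝ x) x := by
  have hn : ‖x‖ ≠ 0 := norm_ne_zero_iff.mpr hx
  have h := (hasStrictFDerivAt_norm_sq x).hasFDerivAt.sqrt (pow_ne_zero 2 hn)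
  simp only [Real.sqrt_sq (norm_nonneg _)] at h
  refine h.congr_fderiv ?_
  ext v
  simp only [smul_apply, smul_eq_mul, nsmul_eq_mul, Nat.cast_ofNat,
    one_div, mul_inv]
  ring

theorem HasDerivAt.hasFDerivAt_comp_norm {φ : ℝ → ℝ} {φ' : ℝ} {x : E3} (hx : x ≠ 0)
    (h : HasDerivAt φ φ' ‖x‖) :
    HasFDerivAt (fun y : E3 => φ ‖y‖) (φ' • ‖x‖⁻¹ • innerSL ℝ x) x :=
  h.comp_hasFDerivAt x (hasFDerivAt_norm_of_ne_zero hx)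

theorem pd_comp_norm {φ : ℝ → ℝ} {φ' : ℝ} {x : E3} (hx : x ≠ 0)
    (h : HasDerivAt φ φ' ‖x‖) (j : Fin 3) :
    pd j (fun y => φ ‖y‖) x = φ' / ‖x‖ * x j := by
  rw [pd, (h.hasFDerivAt_comp_norm hx).fderiv]
  simp [EuclideanSpace.inner_single_right]
  ring

theorem pd_comp_norm_mul_coord {ψ : ℝ → ℝ} {ψ' : ℝ} {x : E3} (hx : x ≠ 0)
    (h : HasDerivAt ψ ψ' ‖x‖) (j : Fin 3) :
    pd j (fun y => ψ ‖y‖ * y j) x = ψ' / ‖x‖ * x j ^ 2 + ψ ‖x‖ := by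
  have hc : HasFDerivAt (fun y : E3 => y j) (EuclideanSpace.proj j : E3 →L[ℝ] ℝ) x :=
    (EuclideanSpace.proj j : E3 →L[ℝ] ℝ).hasFDerivAt
  have hm : HasFDerivAt (fun y : E3 => ψ ‖y‖ * y j) _ x := (h.hasFDerivAt_comp_norm hx).mul hc
  rw [pd, hm.fderiv]
  simp [EuclideanSpace.inner_single_right]
  ring

theorem Filter.EventuallyEq.pd {f g : E3 → ℝ} {x : E3} (h : f =ᶠ[nhds x] g) (j : Fin 3) :
    pd j f =ᶠ[nhds x] pd j g := by
  filter_upwards [h.fderiv (𝕜 := ℝ)] with y hy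
  simp only [_root_.pd, hy]

theorem lap_congr_nhds {f g : E3 → ℝ} {x : E3} (h : f =ᶠ[nhds x] g) : lap f x = lap g x :=
  Finset.sum_congr rfl fun i _ => ((h.pd i).pd i).eq_of_nhds

/-- The Laplacian of a radial function `φ(|x|)` on `E3` is `φ'' + (2 / r) φ'`. -/
theorem lap_comp_norm {φ φ' φ'' : ℝ → ℝ} (h₁ : ∀ r, 0 < r → HasDerivAt φ (φ' r) r)
    (h₂ : ∀ r, 0 < r → HasDerivAt φ' (φ'' r) r) {x : E3} (hx : x ≠ 0) :
    lap (fun y => φ ‖y‖) x = φ'' ‖x‖ + 2 / ‖x‖ * φ' ‖x‖ := by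
  have hr : 0 < ‖x‖ := norm_pos_iff.mpr hx
  have hpd (j : Fin 3) :
      pd j (fun y => φ ‖y‖) =ᶠ[nhds x] fun y => (fun r => φ' r / r) ‖y‖ * y j := by
    filter_upwards [isOpen_ne.mem_nhds hx] with y hy
    exact pd_comp_norm hy (h₁ _ (norm_pos_iff.mpr hy)) j
  have hψ : HasDerivAt (fun r => φ' r / r) ((φ'' ‖x‖ * ‖x‖ - φ' ‖x‖ * 1) / ‖x‖ ^ 2) ‖x‖ :=
    (h₂ _ hr).div (hasDerivAt_id ‖x‖) hr.ne'
  have hpd₂ (j : Fin 3) := ((hpd j).pd j).eq_of_nhds.trans (pd_comp_norm_mul_coord hx hψ j)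
  have hsum : ∑ i, x i ^ 2 = ‖x‖ ^ 2 := (EuclideanSpace.real_norm_sq_eq x).symm
  simp only [lap, hpd₂, Finset.sum_add_distrib, ← Finset.mul_sum, hsum]
  simp only [Finset.sum_const, Finset.card_univ, Fintype.card_fin, nsmul_eq_mul]
  field_simp
  push_cast
  ring

theorem hasDerivAt_erf (t : ℝ) : HasDerivAt erf (2 / √π * exp (-t ^ 2)) t := by
  have hc : Continuous fun s : ℝ => exp (-s ^ 2) := by fun_prop
  exact (hc.integral_hasStrictDerivAt 0 t).hasDerivAt.const_mul _

theorem hasDerivAt_erf_const_mul (ξ r : ℝ) :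
    HasDerivAt (fun r => erf (ξ * r)) (2 / √π * ξ * exp (-ξ ^ 2 * r ^ 2)) r := by
  have h := (hasDerivAt_erf (ξ * r)).comp r ((hasDerivAt_id r).const_mul ξ)
  refine h.congr_deriv ?_
  rw [mul_pow, ← neg_mul]
  ring

theorem hasDerivAt_exp_neg_sq (ξ r : ℝ) :
    HasDerivAt (fun r => exp (-ξ ^ 2 * r ^ 2)) (-2 * ξ ^ 2 * r * exp (-ξ ^ 2 * r ^ 2)) r := by
  refine (((hasDerivAt_pow 2 r).const_mul (-ξ ^ 2)).exp).congr_deriv ?_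
  push_cast
  ring

theorem lap_norm_mul_erf (ξ : ℝ) {x : E3} (hx : x ≠ 0) :
    lap (fun y => ‖y‖ * erf (ξ * ‖y‖)) x
      = 2 * erf (ξ * ‖x‖) / ‖x‖
        + 2 / √π * ξ * (4 - 2 * ξ ^ 2 * ‖x‖ ^ 2) * exp (-ξ ^ 2 * ‖x‖ ^ 2) := by
  have hr : ‖x‖ ≠ 0 := norm_ne_zero_iff.mpr hx
  have h₁ (r : ℝ) (_ : 0 < r) : HasDerivAt (fun r => r * erf (ξ * r))
      (erf (ξ * r) + 2 / √π * ξ * (r * exp (-ξ ^ 2 * r ^ 2))) r :=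
    ((hasDerivAt_id r).mul (hasDerivAt_erf_const_mul ξ r)).congr_deriv (by simp only [id]; ring)
  have h₂ (r : ℝ) (_ : 0 < r) : HasDerivAt
      (fun r => erf (ξ * r) + 2 / √π * ξ * (r * exp (-ξ ^ 2 * r ^ 2)))
      (2 / √π * ξ * (2 - 2 * ξ ^ 2 * r ^ 2) * exp (-ξ ^ 2 * r ^ 2)) r :=
    ((hasDerivAt_erf_const_mul ξ r).add
      (((hasDerivAt_id r).mul (hasDerivAt_exp_neg_sq ξ r)).const_mul (2 / √π * ξ))).congr_deriv
      (by simp only [id]; ring)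
  rw [lap_comp_norm h₁ h₂ hx]
  field_simp
  ring

theorem lap_lap_norm_mul_erf (ξ : ℝ) {x : E3} (hx : x ≠ 0) :
    lap (lap (fun y => ‖y‖ * erf (ξ * ‖y‖))) x
      = -8 / √π * ξ ^ 3 * exp (-ξ ^ 2 * ‖x‖ ^ 2)
        * (10 - 11 * ξ ^ 2 * ‖x‖ ^ 2 + 2 * ξ ^ 4 * ‖x‖ ^ 4) := by
  have hr : ‖x‖ ≠ 0 := norm_ne_zero_iff.mpr hx
  have hlap : lap (fun y => ‖y‖ * erf (ξ * ‖y‖)) =ᶠ[nhds x] fun y => (fun r =>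
      2 * erf (ξ * r) / r + 2 / √π * ξ * (4 - 2 * ξ ^ 2 * r ^ 2) * exp (-ξ ^ 2 * r ^ 2)) ‖y‖ := by
    filter_upwards [isOpen_ne.mem_nhds hx] with y hy
    exact lap_norm_mul_erf ξ hy
  have hq (r : ℝ) : HasDerivAt (fun r => 2 / √π * ξ * (4 - 2 * ξ ^ 2 * r ^ 2))
      (2 / √π * ξ * (-4 * ξ ^ 2 * r)) r :=
    ((((hasDerivAt_pow 2 r).const_mul (2 * ξ ^ 2)).const_sub 4).const_mul _).congr_deriv
      (by push_cast; ring)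
  have hp (r : ℝ) : HasDerivAt (fun r => 2 / √π * ξ * (-12 * ξ ^ 2 * r + 4 * ξ ^ 4 * r ^ 3))
      (2 / √π * ξ * (-12 * ξ ^ 2 + 12 * ξ ^ 4 * r ^ 2)) r :=
    ((((hasDerivAt_id r).const_mul (-12 * ξ ^ 2)).add
      ((hasDerivAt_pow 3 r).const_mul (4 * ξ ^ 4))).const_mul _).congr_deriv
      (by push_cast; ring)
  have h₀ (r : ℝ) (h : 0 < r) : HasDerivAt (fun r => 2 * erf (ξ * r) / r)
      (2 * (2 / √π * ξ * exp (-ξ ^ 2 * r ^ 2)) / r - 2 * erf (ξ * r) / r ^ 2) r :=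
    (((hasDerivAt_erf_const_mul ξ r).const_mul 2).div (hasDerivAt_id r) h.ne').congr_deriv
      (by simp only [id]; field_simp)
  have h₁ (r : ℝ) (h : 0 < r) : HasDerivAt (fun r =>
      2 * erf (ξ * r) / r + 2 / √π * ξ * (4 - 2 * ξ ^ 2 * r ^ 2) * exp (-ξ ^ 2 * r ^ 2))
      (2 * (2 / √π * ξ * exp (-ξ ^ 2 * r ^ 2)) / r - 2 * erf (ξ * r) / r ^ 2
        + 2 / √π * ξ * (-12 * ξ ^ 2 * r + 4 * ξ ^ 4 * r ^ 3) * exp (-ξ ^ 2 * r ^ 2)) r :=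
    ((h₀ r h).add ((hq r).mul (hasDerivAt_exp_neg_sq ξ r))).congr_deriv (by ring)
  have h₂ (r : ℝ) (h : 0 < r) : HasDerivAt (fun r =>
      2 * (2 / √π * ξ * exp (-ξ ^ 2 * r ^ 2)) / r - 2 * erf (ξ * r) / r ^ 2
        + 2 / √π * ξ * (-12 * ξ ^ 2 * r + 4 * ξ ^ 4 * r ^ 3) * exp (-ξ ^ 2 * r ^ 2))
      (4 * erf (ξ * r) / r ^ 3 + 2 / √π * ξ * exp (-ξ ^ 2 * r ^ 2)
        * (-4 / r ^ 2 - 16 * ξ ^ 2 + 36 * ξ ^ 4 * r ^ 2 - 8 * ξ ^ 6 * r ^ 4)) r :=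
    ((((((hasDerivAt_exp_neg_sq ξ r).const_mul (2 / √π * ξ)).const_mul 2).div
      (hasDerivAt_id r) h.ne').sub (((hasDerivAt_erf_const_mul ξ r).const_mul 2).div
      (hasDerivAt_pow 2 r) (pow_ne_zero 2 h.ne'))).add
      ((hp r).mul (hasDerivAt_exp_neg_sq ξ r))).congr_deriv
      (by simp only [id]; push_cast; field_simp; ring)
  rw [lap_congr_nhds hlap, lap_comp_norm h₁ h₂ hx]
  field_simp
  ring

/-- The Beenakker splitting function satisfies the biharmonic relation
`Δ² (|x| erf(ξ|x|)) = −8π γ_B(x, ξ)`. -/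
theorem beenakker_splitting_bilaplacian (ξ : ℝ) (hξ : 0 < ξ) (x : E3) (hx : x ≠ 0) :
    lap (lap (fun y => ‖y‖ * erf (ξ * ‖y‖))) x
      = -(8 * π) * (ξ ^ 3 * π ^ (-(3 : ℝ) / 2) * Real.exp (-ξ ^ 2 * ‖x‖ ^ 2)
          * (10 - 11 * ξ ^ 2 * ‖x‖ ^ 2 + 2 * ξ ^ 4 * ‖x‖ ^ 4)) := by
  have hpi : π ^ (-(3 : ℝ) / 2) = (π * √π)⁻¹ := by
    rw [neg_div, rpow_neg pi_pos.le, show (3 : ℝ) / 2 = 1 + 1 / 2 by norm_num,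
      rpow_add pi_pos, rpow_one, ← sqrt_eq_rpow]
  rw [lap_lap_norm_mul_erf ξ hx, hpi]
  have := pi_ne_zero
  field_simp
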